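/- Let k be a field of characteristic zero and A a commutative unital k-algebra. For every element a of the augmentation ideal I of the Hochschild chain complex C(A) with shuffle product •, one has a − e^{(1)}(a) ∈ I • I; consequently Im(id − e^{(1)}) = Ker(e^{(1)}) ⊆ I • I. -/

import Mathlib

/-!
STATEMENT 3: For every element `a` of the augmentation ideal `I` of the Hochschild chain
complex `C(A)` with shuffle product `•`, one has `a − e^{(1)}(a) ∈ I • I`; consequently
`Im(id − e^{(1)}) = Ker(e^{(1)}) ⊆ I • I` (on the augmentation ideal).
-/

open TensorProduct DirectSum PiTensorProduct

noncomputable section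

variable (k : Type) [Field k] [CharZero k] (V : Type) [AddCommGroup V] [Module k V]

/-- The `n`-th tensor power `V^{⊗n}`. -/
abbrev TPow (n : ℕ) : Type := ⨂[k] (_ : Fin n), V

/-- The tensor module `T(V) = ⊕_{n≥0} V^{⊗n}`. -/
abbrev TMod : Type := ⨁ n : ℕ, TPow k V n

/-- Inclusion of the weight-`n` component. -/
abbrev incl (n : ℕ) : TPow k V n →ₗ[k] TMod k V := DirectSum.lof k ℕ (TPow k V) n

/-- `σ.(x₁ ⊗ … ⊗ xₙ) = x_{σ⁻¹(1)} ⊗ … ⊗ x_{σ⁻¹(n)}`. -/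
def permAct {n : ℕ} (σ : Equiv.Perm (Fin n)) : TPow k V n →ₗ[k] TPow k V n :=
  (PiTensorProduct.reindex k (fun _ : Fin n => V) σ).toLinearMap

/-- Concatenation `V^{⊗p} ⊗ V^{⊗q} → V^{⊗(p+q)}`. -/
def concat (p q : ℕ) : TPow k V p ⊗[k] TPow k V q →ₗ[k] TPow k V (p + q) :=
  (PiTensorProduct.reindex k (fun _ : Fin p ⊕ Fin q => V) finSumFinEquiv).toLinearMap ∘ₗ
    (PiTensorProduct.tmulEquiv (ι := Fin p) (ι₂ := Fin q) k V).toLinearMap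

/-- `(p,q)`-shuffles: permutations of `Fin (p+q)` increasing on the first `p` and
on the last `q` entries. -/
def IsShuffle (p q : ℕ) (σ : Equiv.Perm (Fin (p + q))) : Prop :=
  ∀ i j : Fin (p + q), i < j → ((j : ℕ) < p ∨ p ≤ (i : ℕ)) → σ i < σ j

/-- The finite set of `(p,q)`-shuffles. -/
def shuffles (p q : ℕ) : Finset (Equiv.Perm (Fin (p + q))) :=
  letI := Classical.decPred (IsShuffle p q)
  Finset.univ.filter (IsShuffle p q)

/-- The component `sh_{p,q}` of the (signed, graded) shuffle product. -/
def shMul (p q : ℕ) : TPow k V p ⊗[k] TPow k V q →ₗ[k] TPow k V (p + q) :=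
  ∑ σ ∈ shuffles p q,
    (((Equiv.Perm.sign σ : ℤ) : k)) • (permAct k V σ ∘ₗ concat k V p q)

/-- The shuffle product `μ_sh` as a bilinear map on `T(V)`. -/
def mulBil : TMod k V →ₗ[k] TMod k V →ₗ[k] TMod k V :=
  DirectSum.toModule k ℕ (TMod k V →ₗ[k] TMod k V) fun p =>
    ((DirectSum.toModule k ℕ (TPow k V p →ₗ[k] TMod k V) fun q =>
      (TensorProduct.curry (incl k V (p + q) ∘ₗ shMul k V p q)).flip)).flip

/-- The shuffle product `μ_sh : T(V) ⊗ T(V) → T(V)`. -/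
def mulMap : TMod k V ⊗[k] TMod k V →ₗ[k] TMod k V := TensorProduct.lift (mulBil k V)

/-- Splitting `Fin n ≃ Fin p ⊕ Fin (n-p)` for `p ≤ n`. -/
def splitEquiv (n : ℕ) (p : Fin (n + 1)) : Fin n ≃ (Fin (p : ℕ) ⊕ Fin (n - (p : ℕ))) :=
  (finCongr (Nat.add_sub_cancel' (Nat.lt_succ_iff.mp p.isLt)).symm).trans finSumFinEquiv.symm

/-- Weight-`n` component of the deconcatenation coproduct. -/
def comulComp (n : ℕ) : TPow k V n →ₗ[k] TMod k V ⊗[k] TMod k V :=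
  ∑ p : Fin (n + 1),
    (TensorProduct.map (incl k V (p : ℕ)) (incl k V (n - (p : ℕ)))) ∘ₗ
      (PiTensorProduct.tmulEquiv (ι := Fin (p : ℕ)) (ι₂ := Fin (n - (p : ℕ))) k V).symm.toLinearMap ∘ₗ
      (PiTensorProduct.reindex k (fun _ : Fin n => V) (splitEquiv n p)).toLinearMap

/-- The deconcatenation coproduct `Δ`. -/
def comul : TMod k V →ₗ[k] TMod k V ⊗[k] TMod k V :=
  DirectSum.toModule k ℕ (TMod k V ⊗[k] TMod k V) (comulComp k V)

/-- The counit `ε` : projection onto `V^{⊗0} = k`. -/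
def counit : TMod k V →ₗ[k] k :=
  DirectSum.toModule k ℕ k fun n =>
    match n with
    | 0 => (PiTensorProduct.isEmptyEquiv (Fin 0)).toLinearMap
    | _ + 1 => 0

/-- The unit `1 ∈ V^{⊗0}`. -/
def unitT : TMod k V := incl k V 0 ((PiTensorProduct.isEmptyEquiv (Fin 0)).symm 1)

/-- The map `1ε`, unit of the convolution algebra. -/
def oneEps : TMod k V →ₗ[k] TMod k V :=
  (LinearMap.toSpanSingleton k (TMod k V) (unitT k V)) ∘ₗ counit k V

/-- Convolution product `f ⋆ g = μ_sh ∘ (f ⊗ g) ∘ Δ`. -/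
def conv (f g : TMod k V →ₗ[k] TMod k V) : TMod k V →ₗ[k] TMod k V :=
  mulMap k V ∘ₗ TensorProduct.map f g ∘ₗ comul k V

/-- Convolution powers `f^{⋆n}` (with `f^{⋆0} = 1ε`). -/
def convPow (f : TMod k V →ₗ[k] TMod k V) : ℕ → (TMod k V →ₗ[k] TMod k V)
  | 0 => oneEps k V
  | n + 1 => conv k V f (convPow f n)

/-- `J = id - 1ε`. -/
def J : TMod k V →ₗ[k] TMod k V := LinearMap.id - oneEps k V

/-- The first eulerian idempotent `e^{(1)} = log^⋆(id) = Σ_{n≥1} (-1)^{n+1} J^{⋆n}/n`,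
computed weight-wise (in weight `n` the series truncates at `n`). -/
def euler1 : TMod k V →ₗ[k] TMod k V :=
  DirectSum.toModule k ℕ (TMod k V) fun n =>
    ∑ m ∈ Finset.Icc 1 n,
      ((-1 : k) ^ (m + 1) * (m : k)⁻¹) • (convPow k V (J k V) m ∘ₗ incl k V n)

/-- The augmentation ideal `I = ⊕_{n>0} V^{⊗n}`. -/
def augIdeal : Submodule k (TMod k V) := ⨆ n : ℕ, LinearMap.range (incl k V (n + 1))

/-- The square `I^{•2}` of the augmentation ideal under the shuffle product. -/
def augIdealSq : Submodule k (TMod k V) :=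
  Submodule.span k {z | ∃ x ∈ augIdeal k V, ∃ y ∈ augIdeal k V, z = mulMap k V (x ⊗ₜ[k] y)}


variable (A : Type) [CommRing A] [Algebra k A]

/-- Hochschild chains `C(A) = ⊕_{n≥0} A ⊗ A^{⊗n}`, modelled as `A ⊗ T(A)`. -/
abbrev HChains : Type := A ⊗[k] TMod k A

/-- The shuffle product on Hochschild chains:
`(a₀ ⊗ u) • (b₀ ⊗ v) = (a₀b₀) ⊗ (u •_sh v)`. -/
def mulC : HChains k A ⊗[k] HChains k A →ₗ[k] HChains k A :=
  (TensorProduct.map (LinearMap.mul' k A) (mulMap k A)) ∘ₗ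
    (TensorProduct.tensorTensorTensorComm k A (TMod k A) A (TMod k A)).toLinearMap

/-- The first eulerian idempotent acting on chains, by `eₙ^{(1)} ∈ ℚ[Sₙ]` on the last
`n` tensor factors. -/
def euler1C : HChains k A →ₗ[k] HChains k A :=
  TensorProduct.map LinearMap.id (euler1 k A)

/-- The augmentation ideal `I = ⊕_{n>0} A ⊗ A^{⊗n}` of the Hochschild chains. -/
def augIdealC : Submodule k (HChains k A) :=
  LinearMap.range
    (TensorProduct.map (LinearMap.id : A →ₗ[k] A) (Submodule.subtype (augIdeal k A)))

/-- The square `I^{•2}` of the augmentation ideal under the shuffle product. -/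
def augIdealCSq : Submodule k (HChains k A) :=
  Submodule.span k
    {z | ∃ x ∈ augIdealC k A, ∃ y ∈ augIdealC k A, z = mulC k A (x ⊗ₜ[k] y)}

/-- Shortcut instance (the canonical additive group structure on chains). -/
noncomputable instance : AddCommGroup (A ⊗[k] TMod k A) := inferInstance

/-- The map `id − e^{(1)}` on Hochschild chains. -/
def idSubEuler1C : HChains k A →ₗ[k] HChains k A :=
  LinearMap.id - euler1C k A

section StableSort

variable {α β : Type} [LinearOrder α] [LinearOrder β] {n p q : ℕ}

omit [LinearOrder α] [LinearOrder β] in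
theorem mem_shuffles_iff {σ : Equiv.Perm (Fin (p + q))} :
    σ ∈ shuffles p q ↔ IsShuffle p q σ := by
  simp [shuffles]

omit [LinearOrder α] [LinearOrder β] in
theorem isShuffle_iff {σ : Equiv.Perm (Fin (p + q))} :
    IsShuffle p q σ ↔ StrictMono (fun i : Fin p => σ (Fin.castAdd q i)) ∧
      StrictMono (fun j : Fin q => σ (Fin.natAdd p j)) := by
  refine ⟨fun h => ⟨fun i j hij => h _ _ hij (Or.inl (by simp)),
    fun i j hij => h _ _ (by simpa using hij) (Or.inr (by simp))⟩, fun ⟨h₁, h₂⟩ i j hij hc => ?_⟩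
  induction i using Fin.addCases with
  | left i =>
    induction j using Fin.addCases with
    | left j => exact h₁ hij
    | right j =>
      have := i.isLt
      simp only [Fin.val_natAdd, Fin.val_castAdd] at hc
      omega
  | right i =>
    induction j using Fin.addCases with
    | left j =>
      have := j.isLt
      simp only [Fin.lt_def, Fin.val_natAdd, Fin.val_castAdd] at hij
      omega
    | right j => exact h₂ (by simpa using hij)

/-- If `i` comes before `j` in the stable sort of `w`, then `(w i, i) < (w j, j)`
lexicographically. -/
theorem sort_symm_lt_sort_symm {w : Fin n → α} {i j : Fin n}
    (h : w i < w j ∨ w i = w j ∧ i < j) : (Tuple.sort w).symm i < (Tuple.sort w).symm j := by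
  obtain ⟨hm, hs⟩ := Tuple.eq_sort_iff.1 (rfl : Tuple.sort w = Tuple.sort w)
  by_contra! hle
  rcases hle.eq_or_lt with he | hl
  · have : j = i := (Tuple.sort w).symm.injective he
    subst this
    simp at h
  · have h₁ : w j ≤ w i := by simpa using hm hle
    rcases h with h | ⟨he, hij⟩
    · exact absurd h h₁.not_gt
    · have := hs _ _ hl (by simpa using he.symm)
      simp only [Equiv.apply_symm_apply] at this
      exact absurd hij this.asymm

theorem sort_orderIso_comp (e : α ≃o β) (w : Fin n → α) : Tuple.sort (e ∘ w) = Tuple.sort w := by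
  obtain ⟨hm, hs⟩ := Tuple.eq_sort_iff.1 (rfl : Tuple.sort w = Tuple.sort w)
  refine (Tuple.eq_sort_iff.2 ⟨fun i j hij => ?_, fun i j hij h => hs i j hij ?_⟩).symm
  · simpa using hm hij
  · simpa using h

/-- Juxtaposition of two words, on the ordinal sum of the two alphabets. -/
def mergeWord (u : Fin p → α) (v : Fin q → β) : Fin (p + q) → α ⊕ₗ β :=
  Fin.addCases (fun i => Sum.inlₗ (u i)) (fun j => Sum.inrₗ (v j))

omit [LinearOrder α] [LinearOrder β] in
@[simp]
theorem mergeWord_castAdd (u : Fin p → α) (v : Fin q → β) (i : Fin p) :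
    mergeWord u v (Fin.castAdd q i) = Sum.inlₗ (u i) := by
  simp [mergeWord]

omit [LinearOrder α] [LinearOrder β] in
@[simp]
theorem mergeWord_natAdd (u : Fin p → α) (v : Fin q → β) (j : Fin q) :
    mergeWord u v (Fin.natAdd p j) = Sum.inrₗ (v j) := by
  simp [mergeWord]

/-- The block sum of two permutations. -/
def blockPerm (σ : Equiv.Perm (Fin p)) (τ : Equiv.Perm (Fin q)) : Equiv.Perm (Fin (p + q)) :=
  finSumFinEquiv.permCongr (Equiv.Perm.sumCongr σ τ)

omit [LinearOrder α] [LinearOrder β] in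
@[simp]
theorem blockPerm_castAdd (σ : Equiv.Perm (Fin p)) (τ : Equiv.Perm (Fin q)) (i : Fin p) :
    blockPerm σ τ (Fin.castAdd q i) = Fin.castAdd q (σ i) := by
  simp [blockPerm, Equiv.permCongr_apply]

omit [LinearOrder α] [LinearOrder β] in
@[simp]
theorem blockPerm_natAdd (σ : Equiv.Perm (Fin p)) (τ : Equiv.Perm (Fin q)) (j : Fin q) :
    blockPerm σ τ (Fin.natAdd p j) = Fin.natAdd p (τ j) := by
  simp [blockPerm, Equiv.permCongr_apply]

omit [LinearOrder α] [LinearOrder β] in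
theorem sign_blockPerm (σ : Equiv.Perm (Fin p)) (τ : Equiv.Perm (Fin q)) :
    Equiv.Perm.sign (blockPerm σ τ) = Equiv.Perm.sign σ * Equiv.Perm.sign τ := by
  rw [blockPerm, Equiv.Perm.sign_permCongr, Equiv.Perm.sign_sumCongr]

/-- To recognise the stable sort of a word on an ordinal sum of alphabets, it suffices to look
at the two alphabets separately. -/
theorem eq_sort_of_split {w : Fin (p + q) → α ⊕ₗ β} {σ : Equiv.Perm (Fin (p + q))}
    (u : Fin p → α) (v : Fin q → β)
    (hu : ∀ i, w (σ (Fin.castAdd q i)) = Sum.inlₗ (u i))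
    (hv : ∀ j, w (σ (Fin.natAdd p j)) = Sum.inrₗ (v j))
    (hum : Monotone u) (hvm : Monotone v)
    (hus : ∀ i j, i < j → u i = u j → σ (Fin.castAdd q i) < σ (Fin.castAdd q j))
    (hvs : ∀ i j, i < j → v i = v j → σ (Fin.natAdd p i) < σ (Fin.natAdd p j)) :
    σ = Tuple.sort w := by
  refine Tuple.eq_sort_iff.2 ⟨fun i j hij => ?_, fun i j hij h => ?_⟩
  · simp only [Function.comp_apply]
    induction i using Fin.addCases with
    | left i =>
      induction j using Fin.addCases with
      | left j =>
        rw [hu, hu]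
        exact Sum.Lex.inl_le_inl_iff.2 (hum hij)
      | right j =>
        rw [hu, hv]
        exact Sum.Lex.inl_le_inr _ _
    | right i =>
      induction j using Fin.addCases with
      | left j =>
        have := j.isLt
        simp only [Fin.le_def, Fin.val_natAdd, Fin.val_castAdd] at hij
        omega
      | right j =>
        rw [hv, hv]
        exact Sum.Lex.inr_le_inr_iff.2 (hvm (by simpa using hij))
  · induction i using Fin.addCases with
    | left i =>
      induction j using Fin.addCases with
      | left j =>
        rw [hu, hu] at h
        exact hus i j hij (Sum.inl_injective (toLex.injective h))
      | right j =>
        rw [hu, hv] at h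
        exact absurd (toLex.injective h) Sum.inl_ne_inr
    | right i =>
      induction j using Fin.addCases with
      | left j =>
        rw [hu, hv] at h
        exact absurd (toLex.injective h) Sum.inr_ne_inl
      | right j =>
        rw [hv, hv] at h
        exact hvs i j (by simpa using hij) (Sum.inr_injective (toLex.injective h))

theorem sort_mergeWord_comp {τ : Equiv.Perm (Fin (p + q))} (hτ : IsShuffle p q τ)
    (u : Fin p → α) (v : Fin q → β) :
    Tuple.sort (mergeWord u v ∘ τ.symm) = τ * blockPerm (Tuple.sort u) (Tuple.sort v) := by
  obtain ⟨hτ₁, hτ₂⟩ := isShuffle_iff.1 hτ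
  obtain ⟨hum, hus⟩ := Tuple.eq_sort_iff.1 (rfl : Tuple.sort u = Tuple.sort u)
  obtain ⟨hvm, hvs⟩ := Tuple.eq_sort_iff.1 (rfl : Tuple.sort v = Tuple.sort v)
  refine (eq_sort_of_split (u ∘ Tuple.sort u) (v ∘ Tuple.sort v) (by simp) (by simp) hum hvm
    (fun i j hij h => ?_) (fun i j hij h => ?_)).symm
  · simpa using hτ₁ (hus i j hij h)
  · simpa using hτ₂ (hvs i j hij h)

/-- The set of words with exactly `p` letters in the lower alphabet, expressed through their
stable sort. -/
def IsSplit (p : ℕ) (w : Fin n → α ⊕ₗ β) : Prop :=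
  ∀ i, (ofLex (w (Tuple.sort w i))).isRight = decide (p ≤ (i : ℕ))

theorem monotone_isRight : Monotone fun x : α ⊕ₗ β => (ofLex x).isRight := by
  intro x y h
  induction x using Lex.rec with | _ x
  induction y using Lex.rec with | _ y
  rcases x with x | x <;> rcases y with y | y <;>
    simp at h ⊢

theorem isSplit_iff_of_monotone (w : Fin n → α ⊕ₗ β) {σ : Equiv.Perm (Fin n)}
    (h : Monotone fun i => (ofLex (w (σ i))).isRight) :
    IsSplit p w ↔ ∀ i, (ofLex (w (σ i))).isRight = decide (p ≤ (i : ℕ)) := by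
  have := Tuple.unique_monotone (f := fun i => (ofLex (w i)).isRight) (σ := Tuple.sort w) (τ := σ)
    (monotone_isRight.comp (Tuple.monotone_sort w)) h
  refine forall_congr' fun i => ?_
  have hi := congrFun this i
  simp only [Function.comp_apply] at hi
  rw [hi]

theorem existsUnique_isSplit (w : Fin n → α ⊕ₗ β) :
    ∃! p : Fin (n + 1), IsSplit (p : ℕ) w := by
  set c : Fin n → Bool := fun i => (ofLex (w (Tuple.sort w i))).isRight with hc
  have hm : Monotone c := monotone_isRight.comp (Tuple.monotone_sort w)
  refine ⟨⟨(Finset.univ.filter fun i => c i ≤ false).card, ?_⟩, fun i => ?_, fun p hp => ?_⟩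
  · exact Nat.lt_succ_of_le ((Finset.card_le_univ _).trans_eq (Fintype.card_fin n))
  · have := Tuple.lt_card_le_iff_apply_le_of_monotone (j := i) (a := false) hm
    change c i = _
    rw [Bool.eq_iff_iff, decide_eq_true_iff, ← not_lt, this]
    cases c i <;> simp
  · have hp' : ∀ i, c i = decide ((p : ℕ) ≤ i) := hp
    have hpn := p.isLt
    ext
    have hb : ∀ b : Bool, b ≤ false ↔ b = false := by decide
    simp only [hp', hb, decide_eq_false_iff_not, not_le]
    rw [Fin.card_filter_val_lt]
    omega

omit [LinearOrder α] [LinearOrder β] in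
theorem isRight_mergeWord (u : Fin p → α) (v : Fin q → β) (i : Fin (p + q)) :
    (ofLex (mergeWord u v i)).isRight = decide (p ≤ (i : ℕ)) := by
  induction i using Fin.addCases with
  | left i => simp [Sum.inlₗ]
  | right i => simp [Sum.inrₗ]

theorem monotone_decide_le : Monotone fun i : Fin n => decide (p ≤ (i : ℕ)) := by
  intro i j hij
  simp only [Bool.le_iff_imp, decide_eq_true_eq]
  exact fun h => h.trans hij

theorem isSplit_mergeWord_comp (τ : Equiv.Perm (Fin (p + q)))
    (u : Fin p → α) (v : Fin q → β) : IsSplit p (mergeWord u v ∘ τ.symm) := by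
  refine (isSplit_iff_of_monotone (σ := τ) _ ?_).2 (by simp [isRight_mergeWord])
  simpa [isRight_mergeWord] using monotone_decide_le

theorem sort_eq_of_isShuffle {c : Fin (p + q) → Bool} {τ : Equiv.Perm (Fin (p + q))}
    (hτ : IsShuffle p q τ) (hc : ∀ i, c (τ i) = decide (p ≤ (i : ℕ))) : τ = Tuple.sort c := by
  refine Tuple.eq_sort_iff.2 ⟨?_, fun i j hij h => hτ i j hij ?_⟩
  · rw [show c ∘ τ = _ from funext hc]
    exact monotone_decide_le
  · simp only [hc, decide_eq_decide] at h
    omega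

theorem isShuffle_sort {c : Fin (p + q) → Bool}
    (hc : ∀ i, c (Tuple.sort c i) = decide (p ≤ (i : ℕ))) : IsShuffle p q (Tuple.sort c) := by
  intro i j hij h
  refine (Tuple.eq_sort_iff.1 (rfl : Tuple.sort c = _)).2 i j hij ?_
  rw [hc, hc, decide_eq_decide]
  rw [Fin.lt_def] at hij
  omega

omit [LinearOrder α] [LinearOrder β] in
theorem mergeWord_comp_injective {u u' : Fin p → α} {v v' : Fin q → β}
    {τ τ' : Equiv.Perm (Fin (p + q))} (hτ : IsShuffle p q τ) (hτ' : IsShuffle p q τ')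
    (h : mergeWord u v ∘ τ.symm = mergeWord u' v' ∘ τ'.symm) : u = u' ∧ v = v' ∧ τ = τ' := by
  have h₁ := sort_eq_of_isShuffle (c := fun i => (ofLex ((mergeWord u v ∘ τ.symm) i)).isRight) hτ
    (by simp [isRight_mergeWord])
  have h₂ := sort_eq_of_isShuffle (c := fun i => (ofLex ((mergeWord u' v' ∘ τ'.symm) i)).isRight)
    hτ' (by simp [isRight_mergeWord])
  have hτe : τ = τ' := by rw [h₁, h₂, h]
  subst hτe
  refine ⟨funext fun i => ?_, funext fun j => ?_, rfl⟩
  · have := congrFun h (τ (Fin.castAdd q i))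
    simp only [Function.comp_apply, Equiv.symm_apply_apply, mergeWord_castAdd] at this
    exact Sum.inl_injective (toLex.injective this)
  · have := congrFun h (τ (Fin.natAdd p j))
    simp only [Function.comp_apply, Equiv.symm_apply_apply, mergeWord_natAdd] at this
    exact Sum.inr_injective (toLex.injective this)

omit [LinearOrder α] [LinearOrder β] in
theorem exists_mergeWord_eq {w : Fin (p + q) → α ⊕ₗ β}
    (hw : ∀ i, (ofLex (w i)).isRight = decide (p ≤ (i : ℕ))) :
    ∃ (u : Fin p → α) (v : Fin q → β), mergeWord u v = w := by
  have hu : ∀ i : Fin p, ∃ a, Sum.inlₗ a = w (Fin.castAdd q i) := by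
    intro i
    have := hw (Fin.castAdd q i)
    generalize w (Fin.castAdd q i) = x at this
    induction x using Lex.rec with | _ x
    rcases x with x | x
    · exact ⟨x, rfl⟩
    · have := i.isLt
      simp at *
      omega
  have hv : ∀ j : Fin q, ∃ b, Sum.inrₗ b = w (Fin.natAdd p j) := by
    intro j
    have := hw (Fin.natAdd p j)
    generalize w (Fin.natAdd p j) = x at this
    induction x using Lex.rec with | _ x
    rcases x with x | x
    · simp at this
    · exact ⟨x, rfl⟩
  choose u hu using hu
  choose v hv using hv
  refine ⟨u, v, funext fun i => ?_⟩
  induction i using Fin.addCases with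
  | left i => simp [hu]
  | right j => simp [hv]

theorem IsSplit.exists_mergeWord_comp {w : Fin (p + q) → α ⊕ₗ β} (hw : IsSplit p w) :
    ∃ (u : Fin p → α) (v : Fin q → β) (τ : Equiv.Perm (Fin (p + q))),
      IsShuffle p q τ ∧ mergeWord u v ∘ τ.symm = w := by
  set c : Fin (p + q) → Bool := fun i => (ofLex (w i)).isRight
  have hc := (isSplit_iff_of_monotone (σ := Tuple.sort c) w (Tuple.monotone_sort c)).1 hw
  obtain ⟨u, v, huv⟩ := exists_mergeWord_eq (w := w ∘ Tuple.sort c) hc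
  exact ⟨u, v, Tuple.sort c, isShuffle_sort hc, by ext i; simp [huv]⟩

open Classical in
/-- Shuffling two sorted words amounts to sorting a word on the ordinal sum of the alphabets. -/
theorem sum_shuffles_blockPerm_sort [Fintype α] [Fintype β] {M : Type} [AddCommMonoid M]
    (F : Equiv.Perm (Fin (p + q)) → M) :
    ∑ u : Fin p → α, ∑ v : Fin q → β, ∑ τ ∈ shuffles p q,
        F (τ * blockPerm (Tuple.sort u) (Tuple.sort v)) =
      ∑ w : Fin (p + q) → α ⊕ₗ β with IsSplit p w, F (Tuple.sort w) := by
  simp only [← Finset.sum_product']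
  refine Finset.sum_bij (fun x _ => mergeWord x.1 x.2.1 ∘ x.2.2.symm) ?_ ?_ ?_ ?_
  · rintro ⟨u, v, τ⟩ -
    simpa using isSplit_mergeWord_comp τ u v
  · rintro ⟨u, v, τ⟩ h ⟨u', v', τ'⟩ h' he
    simp only [Finset.mem_product, Finset.mem_univ, true_and, mem_shuffles_iff] at h h'
    obtain ⟨rfl, rfl, rfl⟩ := mergeWord_comp_injective h h' he
    rfl
  · intro w hw
    obtain ⟨u, v, τ, hτ, he⟩ := IsSplit.exists_mergeWord_comp (Finset.mem_filter.1 hw).2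
    exact ⟨(u, v, τ), by simpa [mem_shuffles_iff] using hτ, he⟩
  · rintro ⟨u, v, τ⟩ h
    simp only [Finset.mem_product, Finset.mem_univ, true_and, mem_shuffles_iff] at h
    rw [sort_mergeWord_comp h]

/-- The word on two copies of the alphabet which records, in addition to the letters of `w`,
whether a position comes from the first `p` ones under the permutation `σ`. -/
def tagWord (p : ℕ) (w : Fin n → α) (σ : Equiv.Perm (Fin n)) (i : Fin n) : α ⊕ₗ α :=
  if p ≤ (σ.symm i : ℕ) then Sum.inrₗ (w i) else Sum.inlₗ (w i)

omit [LinearOrder α] [LinearOrder β] in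
theorem elim_tagWord (w : Fin n → α) (σ : Equiv.Perm (Fin n)) (i : Fin n) :
    (ofLex (tagWord p w σ i)).elim id id = w i := by
  unfold tagWord
  split_ifs <;> simp [Sum.inlₗ, Sum.inrₗ]

omit [LinearOrder α] [LinearOrder β] in
theorem isRight_tagWord (w : Fin n → α) (σ : Equiv.Perm (Fin n)) (i : Fin n) :
    (ofLex (tagWord p w σ i)).isRight = decide (p ≤ (σ.symm i : ℕ)) := by
  unfold tagWord
  split_ifs with h <;> simp [Sum.inlₗ, Sum.inrₗ, h]

theorem sort_tagWord {τ : Equiv.Perm (Fin (p + q))} (hτ : IsShuffle p q τ)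
    (w : Fin (p + q) → α) :
    Tuple.sort (tagWord p w (Tuple.sort w * τ)) = Tuple.sort w * τ := by
  obtain ⟨hτ₁, hτ₂⟩ := isShuffle_iff.1 hτ
  obtain ⟨hm, hs⟩ := Tuple.eq_sort_iff.1 (rfl : Tuple.sort w = Tuple.sort w)
  refine (eq_sort_of_split (fun i => w (Tuple.sort w (τ (Fin.castAdd q i))))
    (fun j => w (Tuple.sort w (τ (Fin.natAdd p j)))) (fun i => ?_) (fun j => ?_)
    (hm.comp hτ₁.monotone) (hm.comp hτ₂.monotone)
    (fun i j hij h => hs (τ _) (τ _) (hτ₁ hij) h) (fun i j hij h => hs (τ _) (τ _) (hτ₂ hij) h)).symm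
  · simp only [tagWord, Equiv.symm_apply_apply]
    simp
  · simp only [tagWord, Equiv.symm_apply_apply]
    simp

theorem isSplit_tagWord (w : Fin n → α) (σ : Equiv.Perm (Fin n)) :
    IsSplit p (tagWord p w σ) := by
  refine (isSplit_iff_of_monotone (σ := σ) _ ?_).2 (by simp [isRight_tagWord])
  simpa [isRight_tagWord] using monotone_decide_le

omit [LinearOrder α] in
theorem eq_of_isRight_eq_of_elim_eq {x y : α ⊕ₗ α}
    (h : (ofLex x).isRight = (ofLex y).isRight)
    (h' : (ofLex x).elim id id = (ofLex y).elim id id) : x = y := by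
  induction x using Lex.rec with | _ x
  induction y using Lex.rec with | _ y
  rcases x with x | x <;> rcases y with y | y <;> simp_all

theorem elim_le_elim {x y : α ⊕ₗ α} (h : (ofLex x).isRight = (ofLex y).isRight) (hxy : x ≤ y) :
    (ofLex x).elim id id ≤ (ofLex y).elim id id := by
  induction x using Lex.rec with | _ x
  induction y using Lex.rec with | _ y
  rcases x with x | x <;> rcases y with y | y <;> simp_all

theorem IsSplit.isShuffle_sort_symm_mul {w : Fin (p + q) → α ⊕ₗ α} (hw : IsSplit p w) :
    IsShuffle p q ((Tuple.sort fun i => (ofLex (w i)).elim id id).symm * Tuple.sort w) := by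
  intro i j hij h
  obtain ⟨hm, hs⟩ := Tuple.eq_sort_iff.1 (rfl : Tuple.sort w = Tuple.sort w)
  have hr : (ofLex (w (Tuple.sort w i))).isRight = (ofLex (w (Tuple.sort w j))).isRight := by
    rw [hw, hw, decide_eq_decide]
    rw [Fin.lt_def] at hij
    omega
  refine sort_symm_lt_sort_symm ((elim_le_elim hr (hm hij.le)).lt_or_eq.imp_right fun he => ?_)
  exact ⟨he, hs i j hij (eq_of_isRight_eq_of_elim_eq hr he)⟩

open Classical in
/-- Sorting a shuffle of two words amounts to sorting a word on two copies of the alphabet. -/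
theorem sum_sort_mul_shuffles [Fintype α] {M : Type} [AddCommMonoid M]
    (F : Equiv.Perm (Fin (p + q)) → M) :
    ∑ w : Fin (p + q) → α, ∑ τ ∈ shuffles p q, F (Tuple.sort w * τ) =
      ∑ w : Fin (p + q) → α ⊕ₗ α with IsSplit p w, F (Tuple.sort w) := by
  rw [← Finset.sum_product']
  refine Finset.sum_bij (fun x _ => tagWord p x.1 (Tuple.sort x.1 * x.2)) ?_ ?_ ?_ ?_
  · rintro ⟨w, τ⟩ -
    simpa using isSplit_tagWord w _
  · rintro ⟨w, τ⟩ h ⟨w', τ'⟩ h' he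
    simp only [Finset.mem_product, Finset.mem_univ, true_and, mem_shuffles_iff] at h h'
    have hw : w = w' := by
      ext i
      have := congrArg (fun f => (ofLex (f i)).elim id id) he
      simpa only [elim_tagWord] using this
    subst hw
    have := congrArg Tuple.sort he
    simp only [sort_tagWord h, sort_tagWord h', mul_right_inj] at this
    rw [this]
  · intro w hw
    have hw := (Finset.mem_filter.1 hw).2
    refine ⟨(fun i => (ofLex (w i)).elim id id,
      (Tuple.sort fun i => (ofLex (w i)).elim id id).symm * Tuple.sort w),
      by simpa [mem_shuffles_iff] using hw.isShuffle_sort_symm_mul, funext fun i => ?_⟩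
    refine eq_of_isRight_eq_of_elim_eq ?_ (elim_tagWord _ _ i)
    rw [isRight_tagWord]
    have := hw ((Tuple.sort w).symm i)
    rw [Equiv.apply_symm_apply] at this
    rw [this]
    simp [← Equiv.Perm.inv_def]
  · rintro ⟨w, τ⟩ h
    simp only [Finset.mem_product, Finset.mem_univ, true_and, mem_shuffles_iff] at h
    rw [sort_tagWord h]

end StableSort

section SortSum

omit [CharZero k]

variable {k V}
variable {n p q : ℕ}

variable (k V) in
/-- The action of a permutation, twisted by the signature. -/
def signedPerm (σ : Equiv.Perm (Fin n)) : TPow k V n →ₗ[k] TPow k V n :=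
  ((Equiv.Perm.sign σ : ℤ) : k) • permAct k V σ

theorem permAct_mul (σ τ : Equiv.Perm (Fin n)) :
    permAct k V (σ * τ) = permAct k V σ ∘ₗ permAct k V τ := by
  ext x
  simp [permAct, Equiv.Perm.mul_def]

theorem signedPerm_mul (σ τ : Equiv.Perm (Fin n)) :
    signedPerm k V (σ * τ) = signedPerm k V σ ∘ₗ signedPerm k V τ := by
  simp [signedPerm, permAct_mul, LinearMap.smul_comp, LinearMap.comp_smul, smul_smul, mul_comm]

theorem symm_blockPerm (σ : Equiv.Perm (Fin p)) (τ : Equiv.Perm (Fin q)) :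
    (blockPerm σ τ).symm = blockPerm σ.symm τ.symm :=
  rfl

theorem concat_map_permAct (σ : Equiv.Perm (Fin p)) (τ : Equiv.Perm (Fin q)) :
    concat k V p q ∘ₗ TensorProduct.map (permAct k V σ) (permAct k V τ) =
      permAct k V (blockPerm σ τ) ∘ₗ concat k V p q := by
  ext x y
  simp only [concat, permAct, LinearMap.compMultilinearMap_apply,
    TensorProduct.AlgebraTensorModule.curry_apply, LinearMap.coe_restrictScalars,
    TensorProduct.curry_apply, LinearMap.comp_apply, TensorProduct.map_tmul, LinearEquiv.coe_coe,
    PiTensorProduct.reindex_tprod, PiTensorProduct.tmulEquiv_apply]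
  congr 1
  ext i
  induction i using Fin.addCases with
  | left i => simp [symm_blockPerm]
  | right i => simp [symm_blockPerm]

theorem concat_map_signedPerm (σ : Equiv.Perm (Fin p)) (τ : Equiv.Perm (Fin q)) :
    concat k V p q ∘ₗ TensorProduct.map (signedPerm k V σ) (signedPerm k V τ) =
      signedPerm k V (blockPerm σ τ) ∘ₗ concat k V p q := by
  simp only [signedPerm, TensorProduct.map_smul_left, TensorProduct.map_smul_right, sign_blockPerm,
    LinearMap.comp_smul, LinearMap.smul_comp, concat_map_permAct, smul_smul]
  simp [mul_comm]

theorem shMul_eq_sum_signedPerm :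
    shMul k V p q = ∑ σ ∈ shuffles p q, signedPerm k V σ ∘ₗ concat k V p q := by
  simp [shMul, signedPerm, LinearMap.smul_comp]

variable (k V) (α β : Type) [LinearOrder α] [Fintype α] [LinearOrder β] [Fintype β]

/-- The signed sum, over all words of length `n`, of the permutations which sort them. -/
def sortSum (n : ℕ) : TPow k V n →ₗ[k] TPow k V n :=
  ∑ w : Fin n → α, signedPerm k V (Tuple.sort w)

open Classical in
theorem shMul_map_sortSum :
    shMul k V p q ∘ₗ TensorProduct.map (sortSum k V α p) (sortSum k V β q) =
      ∑ w : Fin (p + q) → α ⊕ₗ β with IsSplit p w,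
        signedPerm k V (Tuple.sort w) ∘ₗ concat k V p q := by
  rw [← sum_shuffles_blockPerm_sort fun σ => signedPerm k V σ ∘ₗ concat k V p q]
  refine TensorProduct.ext' fun x y => ?_
  simp only [LinearMap.comp_apply, TensorProduct.map_tmul, sortSum, LinearMap.sum_apply,
    TensorProduct.sum_tmul, TensorProduct.tmul_sum, map_sum, shMul_eq_sum_signedPerm,
    signedPerm_mul]
  rw [Finset.sum_comm]
  refine Finset.sum_congr rfl fun u _ => Finset.sum_congr rfl fun v _ =>
    Finset.sum_congr rfl fun τ _ => ?_
  congr 1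
  exact LinearMap.congr_fun (concat_map_signedPerm (Tuple.sort u) (Tuple.sort v)) (x ⊗ₜ y)

open Classical in
theorem sortSum_comp_shMul :
    sortSum k V α (p + q) ∘ₗ shMul k V p q =
      ∑ w : Fin (p + q) → α ⊕ₗ α with IsSplit p w,
        signedPerm k V (Tuple.sort w) ∘ₗ concat k V p q := by
  rw [← sum_sort_mul_shuffles fun σ => signedPerm k V σ ∘ₗ concat k V p q]
  ext1
  refine LinearMap.ext fun x => LinearMap.ext fun y => ?_
  simp [sortSum, shMul_eq_sum_signedPerm, signedPerm_mul]

theorem sortSum_comp_shMul_eq :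
    sortSum k V α (p + q) ∘ₗ shMul k V p q =
      shMul k V p q ∘ₗ TensorProduct.map (sortSum k V α p) (sortSum k V α q) := by
  rw [sortSum_comp_shMul, shMul_map_sortSum]

/-- The endomorphism of the tensor module given by `sortSum` in each weight. It turns out to be
the convolution power of the identity whose exponent is the cardinality of the alphabet. -/
def adams : TMod k V →ₗ[k] TMod k V :=
  DirectSum.toModule k ℕ (TMod k V) fun n => incl k V n ∘ₗ sortSum k V α n

@[simp]
theorem adams_incl (x : TPow k V n) :
    adams k V α (incl k V n x) = incl k V n (sortSum k V α n x) := by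
  simp [adams, incl]

@[simp]
theorem mulMap_incl (z : TPow k V p ⊗[k] TPow k V q) :
    mulMap k V (TensorProduct.map (incl k V p) (incl k V q) z) =
      incl k V (p + q) (shMul k V p q z) := by
  induction z with
  | zero => simp
  | add x y hx hy => simp only [map_add, hx, hy]
  | tmul x y => simp [mulMap, mulBil, incl]

open Classical in
theorem incl_sum_reindex {m : ℕ} (h : n = m) (x : TPow k V n) :
    incl k V m (∑ w : Fin m → α ⊕ₗ β with IsSplit p w, signedPerm k V (Tuple.sort w)
        (PiTensorProduct.reindex k (fun _ => V) (finCongr h) x)) =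
      incl k V n (∑ w : Fin n → α ⊕ₗ β with IsSplit p w, signedPerm k V (Tuple.sort w) x) := by
  subst h
  simp

theorem conv_adams : conv k V (adams k V α) (adams k V β) = adams k V (α ⊕ₗ β) := by
  classical
  refine DirectSum.linearMap_ext k fun n => LinearMap.ext fun x => ?_
  have key : ∀ r : Fin (n + 1), mulMap k V (TensorProduct.map (adams k V α) (adams k V β)
      (TensorProduct.map (incl k V r) (incl k V (n - r))
        ((PiTensorProduct.tmulEquiv k V).symm
          (PiTensorProduct.reindex k (fun _ => V) (splitEquiv n r) x)))) =
      incl k V n (∑ w : Fin n → α ⊕ₗ β with IsSplit (r : ℕ) w,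
        signedPerm k V (Tuple.sort w) x) := by
    intro r
    rw [← incl_sum_reindex k V α β (Nat.add_sub_cancel' (Nat.lt_succ_iff.mp r.isLt)).symm]
    set z := (PiTensorProduct.tmulEquiv k V).symm
      (PiTensorProduct.reindex k (fun _ => V) (splitEquiv n r) x) with hz
    have h₁ : PiTensorProduct.reindex k (fun _ => V)
        (finCongr (Nat.add_sub_cancel' (Nat.lt_succ_iff.mp r.isLt)).symm) x =
        concat k V r (n - r) z := by
      have he : (splitEquiv n r).trans finSumFinEquiv =
          finCongr (Nat.add_sub_cancel' (Nat.lt_succ_iff.mp r.isLt)).symm := by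
        ext
        simp [splitEquiv]
      simp only [hz, concat, LinearMap.comp_apply, LinearEquiv.coe_coe,
        LinearEquiv.apply_symm_apply, ← he]
      exact (PiTensorProduct.reindex_reindex _ _ _).symm
    have h₂ : TensorProduct.map (adams k V α) (adams k V β)
        (TensorProduct.map (incl k V r) (incl k V (n - r)) z) =
        TensorProduct.map (incl k V r) (incl k V (n - r))
          (TensorProduct.map (sortSum k V α r) (sortSum k V β (n - r)) z) := by
      induction z with
      | zero => simp
      | add x y hx hy => simp only [map_add, hx, hy]
      | tmul x y => simp
    rw [h₁, h₂, mulMap_incl]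
    have := LinearMap.congr_fun (shMul_map_sortSum k V α β (p := r) (q := n - r)) z
    simp only [LinearMap.comp_apply, LinearMap.sum_apply] at this
    rw [this]
  have hsum : ∑ r : Fin (n + 1), ∑ w : Fin n → α ⊕ₗ β with IsSplit (r : ℕ) w,
      signedPerm k V (Tuple.sort w) x = sortSum k V (α ⊕ₗ β) n x := by
    simp only [Finset.sum_filter]
    rw [Finset.sum_comm, sortSum, LinearMap.sum_apply]
    refine Finset.sum_congr rfl fun w _ => ?_
    obtain ⟨r, hr, hu⟩ := existsUnique_isSplit w
    rw [Finset.sum_eq_single r (fun s _ hs => if_neg fun h => hs (hu s h)) (by simp), if_pos hr]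
  simp only [LinearMap.comp_apply]
  rw [adams_incl, ← hsum, map_sum]
  simp only [← key]
  simp [conv, comul, comulComp, incl]

variable {α β} in
theorem adams_congr (e : α ≃o β) : adams k V α = adams k V β := by
  refine DirectSum.linearMap_ext k fun n => LinearMap.ext fun x => ?_
  simp only [LinearMap.comp_apply, adams_incl, sortSum]
  congr 2
  refine Fintype.sum_equiv (Equiv.arrowCongr (Equiv.refl (Fin n)) e.toEquiv) _ _ fun w => ?_
  rw [← sort_orderIso_comp e w]
  rfl

theorem adams_eq_adams_fin {m : ℕ} (h : Fintype.card α = m) :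
    adams k V α = adams k V (Fin m) :=
  adams_congr k V (Fintype.orderIsoFinOfCardEq α h).symm

theorem conv_adams_fin (l m : ℕ) :
    conv k V (adams k V (Fin l)) (adams k V (Fin m)) = adams k V (Fin (m + l)) := by
  rw [conv_adams, adams_eq_adams_fin]
  simp [Lex, add_comm]

theorem adams_one : adams k V (Fin 1) = LinearMap.id := by
  refine DirectSum.linearMap_ext k fun n => LinearMap.ext fun x => ?_
  have : Tuple.sort (fun _ : Fin n => (0 : Fin 1)) = Equiv.refl _ :=
    Tuple.sort_eq_refl_iff_monotone.2 fun _ _ _ => le_rfl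
  simp [sortSum, signedPerm, permAct, this]

theorem oneEps_incl_zero (x : TPow k V 0) : oneEps k V (incl k V 0 x) = incl k V 0 x := by
  simp only [oneEps, counit, incl, unitT, LinearMap.comp_apply, DirectSum.toModule_lof,
    LinearMap.toSpanSingleton_apply, LinearEquiv.coe_coe, ← map_smul]
  simp

theorem oneEps_incl_succ (x : TPow k V (n + 1)) : oneEps k V (incl k V (n + 1) x) = 0 := by
  simp [oneEps, counit, incl]

theorem adams_zero : adams k V (Fin 0) = oneEps k V := by
  refine DirectSum.linearMap_ext k fun n => LinearMap.ext fun x => ?_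
  simp only [LinearMap.comp_apply, adams_incl]
  cases n with
  | zero =>
    rw [oneEps_incl_zero]
    have : Tuple.sort (default : Fin 0 → Fin 0) = Equiv.refl _ := Subsingleton.elim _ _
    rw [sortSum, Fintype.sum_unique, this]
    simp [signedPerm, permAct]
  | succ n =>
    rw [oneEps_incl_succ]
    simp [sortSum]

end SortSum

section ConvPow

omit [CharZero k]

/-- Convolution by `J` on the left, as a linear map. -/
def convJ : (TMod k V →ₗ[k] TMod k V) →ₗ[k] (TMod k V →ₗ[k] TMod k V) where
  toFun := conv k V (J k V)
  map_add' f g := by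
    simp [conv, TensorProduct.map_add_right, LinearMap.add_comp, LinearMap.comp_add]
  map_smul' c f := by
    simp [conv, TensorProduct.map_smul_right, LinearMap.smul_comp, LinearMap.comp_smul]

theorem J_eq_sub : J k V = adams k V (Fin 1) - adams k V (Fin 0) := by
  rw [adams_one, adams_zero, J]

theorem conv_J_eq_sub (f : TMod k V →ₗ[k] TMod k V) :
    conv k V (J k V) f =
      conv k V (adams k V (Fin 1)) f - conv k V (adams k V (Fin 0)) f := by
  have h : adams k V (Fin 1) = J k V + adams k V (Fin 0) := by
    refine LinearMap.ext fun x => ?_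
    rw [J_eq_sub]
    exact (sub_add_cancel _ _).symm
  have h' : conv k V (adams k V (Fin 1)) f =
      conv k V (J k V) f + conv k V (adams k V (Fin 0)) f := by
    rw [h]
    simp only [conv, TensorProduct.map_add_left, LinearMap.add_comp, LinearMap.comp_add]
  rw [h']
  exact LinearMap.ext fun x => (add_sub_cancel_right _ _).symm

theorem convJ_adams (m : ℕ) :
    convJ k V (adams k V (Fin m)) = adams k V (Fin (m + 1)) - adams k V (Fin m) :=
  (conv_J_eq_sub k V _).trans
    (congrArg₂ (· - ·) (conv_adams_fin k V 1 m) (conv_adams_fin k V 0 m))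

theorem convJ_iterate_fwdDiff_adams (j m : ℕ) :
    convJ k V ((fwdDiff 1)^[j] (fun m => adams k V (Fin m)) m) =
      (fwdDiff 1)^[j + 1] (fun m => adams k V (Fin m)) m := by
  induction j generalizing m with
  | zero => simp [fwdDiff, convJ_adams]
  | succ j ih =>
    calc convJ k V ((fwdDiff 1)^[j + 1] (fun m => adams k V (Fin m)) m)
        = convJ k V ((fwdDiff 1)^[j] (fun m => adams k V (Fin m)) (m + 1) -
            (fwdDiff 1)^[j] (fun m => adams k V (Fin m)) m) := by
          rw [Function.iterate_succ_apply', fwdDiff]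
      _ = (fwdDiff 1)^[j + 1 + 1] (fun m => adams k V (Fin m)) m := by
          rw [Function.iterate_succ_apply' _ (j + 1), fwdDiff, ← ih, ← ih]
          exact map_sub (convJ k V) _ _

theorem convPow_J_eq_fwdDiff (j : ℕ) :
    convPow k V (J k V) j = (fwdDiff 1)^[j] (fun m => adams k V (Fin m)) 0 := by
  induction j with
  | zero => simp [convPow, adams_zero]
  | succ j ih =>
    rw [← convJ_iterate_fwdDiff_adams, ← ih]
    rfl

theorem adams_eq_sum_convPow (m : ℕ) :
    adams k V (Fin m) = ∑ j ∈ Finset.range (m + 1), m.choose j • convPow k V (J k V) j := by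
  have := shift_eq_sum_fwdDiff_iter 1 (fun m => adams k V (Fin m)) m 0
  rw [smul_eq_mul, mul_one, zero_add] at this
  simpa only [← convPow_J_eq_fwdDiff] using this

theorem convPow_J_one : convPow k V (J k V) 1 = J k V := by
  rw [convPow_J_eq_fwdDiff]
  simp [fwdDiff, J_eq_sub]

variable {k V} {n : ℕ}

theorem J_incl_zero (x : TPow k V 0) : J k V (incl k V 0 x) = 0 := by
  simp only [J, LinearMap.sub_apply, LinearMap.id_apply, oneEps_incl_zero, sub_self]

theorem J_incl_succ (x : TPow k V (n + 1)) :
    J k V (incl k V (n + 1) x) = incl k V (n + 1) x := by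
  simp only [J, LinearMap.sub_apply, LinearMap.id_apply, oneEps_incl_succ, sub_zero]

theorem convPow_J_incl_eq_zero {m : ℕ} (h : n < m) (x : TPow k V n) :
    convPow k V (J k V) m (incl k V n x) = 0 := by
  induction m generalizing n with
  | zero => omega
  | succ m ih =>
    have key : ∀ r : Fin (n + 1), TensorProduct.map (J k V) (convPow k V (J k V) m) ∘ₗ
        TensorProduct.map (incl k V r) (incl k V (n - r)) = 0 := by
      rintro ⟨r, hr⟩
      rw [← TensorProduct.map_comp]
      cases r with
      | zero =>
        rw [show J k V ∘ₗ incl k V 0 = 0 from LinearMap.ext J_incl_zero]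
        exact TensorProduct.map_zero_left _
      | succ r =>
        rw [show convPow k V (J k V) m ∘ₗ incl k V (n - (r + 1)) = 0 from
          LinearMap.ext fun y => ih (by omega) y]
        exact TensorProduct.map_zero_right _
    simp only [convPow, conv, comul, comulComp, incl, LinearMap.comp_apply, DirectSum.toModule_lof,
      LinearMap.sum_apply, map_sum]
    refine Finset.sum_eq_zero fun r _ => ?_
    have := LinearMap.congr_fun (key r) ((PiTensorProduct.tmulEquiv k V).symm
      (PiTensorProduct.reindex k (fun _ => V) (splitEquiv n r) x))
    simp only [LinearMap.comp_apply, LinearMap.zero_apply] at this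
    exact (congrArg _ this).trans (map_zero _)

theorem adams_incl_succ (m : ℕ) (x : TPow k V (n + 1)) :
    adams k V (Fin m) (incl k V (n + 1) x) =
      ∑ j ∈ Finset.Icc 1 (n + 1),
        (m.choose j : k) • convPow k V (J k V) j (incl k V (n + 1) x) := by
  rw [adams_eq_sum_convPow]
  simp only [LinearMap.sum_apply, LinearMap.smul_apply, ← Nat.cast_smul_eq_nsmul k]
  trans ∑ j ∈ Finset.range (m + n + 2),
    (m.choose j : k) • convPow k V (J k V) j (incl k V (n + 1) x)
  · refine Finset.sum_subset (fun j hj => ?_) fun j _ hj => ?_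
    · simp only [Finset.mem_range] at *
      omega
    · rw [Nat.choose_eq_zero_of_lt (by simpa using hj)]
      simp
  · refine (Finset.sum_subset (fun j hj => ?_) fun j _ hj => ?_).symm
    · simp only [Finset.mem_range, Finset.mem_Icc] at *
      omega
    · rcases Nat.eq_zero_or_pos j with rfl | hj0
      · simp only [convPow, oneEps_incl_succ, smul_zero]
      · rw [convPow_J_incl_eq_zero (by simp only [Finset.mem_Icc] at hj; omega), smul_zero]

end ConvPow

section BinomialCoefficients

open Polynomial

variable {k}

omit [CharZero k] in
theorem coeff_zero_descPochhammer_succ (j : ℕ) : (descPochhammer k (j + 1)).coeff 0 = 0 := by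
  rw [coeff_zero_eq_eval_zero, descPochhammer_eval_zero]
  simp

omit [CharZero k] in
theorem coeff_one_descPochhammer_succ (j : ℕ) :
    (descPochhammer k (j + 1)).coeff 1 = (-1) ^ j * (j.factorial : k) := by
  induction j with
  | zero => simp
  | succ j ih =>
    rw [descPochhammer_succ_right, mul_coeff_one, coeff_zero_descPochhammer_succ, ih]
    simp [Nat.factorial_succ, pow_succ]
    ring

variable (k) in
/-- The polynomial function `m ↦ m.choose j`. -/
def choosePoly (j : ℕ) : k[X] := C ((j.factorial : k)⁻¹) * descPochhammer k j

theorem eval_choosePoly (j m : ℕ) : (choosePoly k j).eval (m : k) = m.choose j := by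
  have : (j.factorial : k) ≠ 0 := Nat.cast_ne_zero.2 j.factorial_ne_zero
  rw [choosePoly, eval_mul, eval_C, descPochhammer_eval_eq_descFactorial,
    Nat.descFactorial_eq_factorial_mul_choose, Nat.cast_mul, inv_mul_cancel_left₀ this]

omit [CharZero k] in
theorem coeff_zero_choosePoly {j : ℕ} (hj : 1 ≤ j) : (choosePoly k j).coeff 0 = 0 := by
  obtain ⟨j, rfl⟩ := Nat.exists_eq_add_of_le' hj
  rw [choosePoly, coeff_C_mul, coeff_zero_descPochhammer_succ, mul_zero]

theorem coeff_one_choosePoly {j : ℕ} (hj : 1 ≤ j) :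
    (choosePoly k j).coeff 1 = (-1) ^ (j + 1) * (j : k)⁻¹ := by
  obtain ⟨j, rfl⟩ := Nat.exists_eq_add_of_le' hj
  have h₁ : (j.factorial : k) ≠ 0 := Nat.cast_ne_zero.2 j.factorial_ne_zero
  have h₂ : ((j + 1 : ℕ) : k) ≠ 0 := Nat.cast_ne_zero.2 j.succ_ne_zero
  rw [choosePoly, coeff_C_mul, coeff_one_descPochhammer_succ, Nat.factorial_succ, Nat.cast_mul]
  field_simp
  ring

theorem sum_inv_mul_eq_zero_of_sum_choose_mul {s t u : Finset ℕ} (hs : ∀ j ∈ s, 1 ≤ j)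
    (ht : ∀ j ∈ t, 1 ≤ j) (hu : ∀ j ∈ u, 1 ≤ j) (a : ℕ → k) (b : ℕ → ℕ → k)
    (h : ∀ m : ℕ, ∑ j ∈ s, (m.choose j : k) * a j =
      ∑ i ∈ t, ∑ j ∈ u, (m.choose i : k) * (m.choose j : k) * b i j) :
    ∑ j ∈ s, (-1) ^ (j + 1) * (j : k)⁻¹ * a j = 0 := by
  have hpoly : ∑ j ∈ s, choosePoly k j * C (a j) =
      ∑ i ∈ t, ∑ j ∈ u, choosePoly k i * choosePoly k j * C (b i j) := by
    refine eq_of_infinite_eval_eq _ _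
      ((Set.infinite_range_of_injective (Nat.cast_injective (R := k))).mono ?_)
    rintro _ ⟨m, rfl⟩
    simpa only [Set.mem_ofPred_eq, eval_finsetSum, eval_mul, eval_C, eval_choosePoly] using h m
  have hcoeff := congrArg (fun P : k[X] => P.coeff 1) hpoly
  simp only [finsetSum_coeff, coeff_mul_C] at hcoeff
  rw [Finset.sum_congr rfl fun j hj => by rw [← coeff_one_choosePoly (hs j hj)], hcoeff]
  refine Finset.sum_eq_zero fun i hi => Finset.sum_eq_zero fun j hj => ?_
  rw [mul_coeff_one, coeff_zero_choosePoly (ht i hi), coeff_zero_choosePoly (hu j hj)]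
  ring

end BinomialCoefficients

section Euler

omit [CharZero k]

variable {k V} {n p q : ℕ}

theorem euler1_incl (x : TPow k V n) :
    euler1 k V (incl k V n x) = ∑ m ∈ Finset.Icc 1 n,
      ((-1 : k) ^ (m + 1) * (m : k)⁻¹) • convPow k V (J k V) m (incl k V n x) := by
  simp [euler1, incl]

theorem adams_mulMap_incl (α : Type) [LinearOrder α] [Fintype α]
    (x : TPow k V p) (y : TPow k V q) :
    adams k V α (mulMap k V (incl k V p x ⊗ₜ incl k V q y)) =
      mulMap k V (adams k V α (incl k V p x) ⊗ₜ adams k V α (incl k V q y)) := by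
  simp only [adams_incl]
  rw [← TensorProduct.map_tmul, ← TensorProduct.map_tmul, mulMap_incl, mulMap_incl, adams_incl,
    ← TensorProduct.map_tmul (sortSum k V α p)]
  exact congrArg _ (LinearMap.congr_fun (sortSum_comp_shMul_eq k V α) (x ⊗ₜ y))

theorem euler1_mulMap_incl [CharZero k] (x : TPow k V (p + 1)) (y : TPow k V (q + 1)) :
    euler1 k V (mulMap k V (incl k V (p + 1) x ⊗ₜ incl k V (q + 1) y)) = 0 := by
  obtain ⟨z, hz⟩ : ∃ z : TPow k V (p + 1 + q + 1),
      mulMap k V (incl k V (p + 1) x ⊗ₜ incl k V (q + 1) y) = incl k V (p + 1 + q + 1) z :=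
    ⟨_, by rw [← TensorProduct.map_tmul, mulMap_incl]; rfl⟩
  have h : ∀ m : ℕ, ∑ j ∈ Finset.Icc 1 (p + 1 + q + 1),
      (m.choose j : k) • convPow k V (J k V) j (incl k V (p + 1 + q + 1) z) =
      ∑ i ∈ Finset.Icc 1 (p + 1), ∑ j ∈ Finset.Icc 1 (q + 1),
        ((m.choose i : k) * (m.choose j : k)) •
          mulMap k V (convPow k V (J k V) i (incl k V (p + 1) x) ⊗ₜ
            convPow k V (J k V) j (incl k V (q + 1) y)) := by
    intro m
    rw [← adams_incl_succ, ← hz, adams_mulMap_incl, adams_incl_succ, adams_incl_succ]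
    simp only [TensorProduct.sum_tmul, TensorProduct.tmul_sum, map_sum, ← TensorProduct.smul_tmul',
      TensorProduct.tmul_smul, map_smul, Finset.smul_sum, smul_smul]
    rw [Finset.sum_comm]
    simp only [mul_comm]
  rw [hz, euler1_incl, ← Module.forall_dual_apply_eq_zero_iff k]
  intro φ
  have := sum_inv_mul_eq_zero_of_sum_choose_mul (k := k) (s := Finset.Icc 1 (p + 1 + q + 1))
    (t := Finset.Icc 1 (p + 1)) (u := Finset.Icc 1 (q + 1))
    (fun j hj => (Finset.mem_Icc.1 hj).1) (fun j hj => (Finset.mem_Icc.1 hj).1)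
    (fun j hj => (Finset.mem_Icc.1 hj).1)
    (fun j => φ (convPow k V (J k V) j (incl k V (p + 1 + q + 1) z)))
    (fun i j => φ (mulMap k V (convPow k V (J k V) i (incl k V (p + 1) x) ⊗ₜ
            convPow k V (J k V) j (incl k V (q + 1) y))))
    (fun m => by simpa only [map_sum, map_smul, smul_eq_mul] using congrArg φ (h m))
  simpa only [map_sum, map_smul, smul_eq_mul] using this

theorem incl_succ_mem_augIdeal (x : TPow k V (n + 1)) : incl k V (n + 1) x ∈ augIdeal k V :=
  Submodule.mem_iSup_of_mem n ⟨x, rfl⟩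

@[elab_as_elim]
theorem augIdeal_induction {motive : (u : TMod k V) → u ∈ augIdeal k V → Prop}
    (incl_succ : ∀ (n : ℕ) (x : TPow k V (n + 1)),
      motive (incl k V (n + 1) x) (incl_succ_mem_augIdeal x))
    (zero : motive 0 (zero_mem _))
    (add : ∀ u v hu hv, motive u hu → motive v hv → motive (u + v) (add_mem hu hv))
    {u : TMod k V} (hu : u ∈ augIdeal k V) : motive u hu := by
  refine Submodule.iSup_induction' _ (motive := motive) ?_ zero (fun u v hu hv => add u v hu hv) hu
  rintro n _ ⟨x, rfl⟩
  exact incl_succ n x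

theorem euler1_mulMap [CharZero k] {u v : TMod k V} (hu : u ∈ augIdeal k V)
    (hv : v ∈ augIdeal k V) :
    euler1 k V (mulMap k V (u ⊗ₜ v)) = 0 := by
  induction hu using augIdeal_induction with
  | zero => simp
  | add u u' _ _ h h' => rw [TensorProduct.add_tmul, map_add, map_add, h, h', add_zero]
  | incl_succ p x =>
    induction hv using augIdeal_induction with
    | zero => simp
    | add v v' _ _ h h' => rw [TensorProduct.tmul_add, map_add, map_add, h, h', add_zero]
    | incl_succ q y => exact euler1_mulMap_incl x y

theorem mulMap_tmul_mem_augIdeal {u v : TMod k V} (hu : u ∈ augIdeal k V)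
    (hv : v ∈ augIdeal k V) : mulMap k V (u ⊗ₜ v) ∈ augIdeal k V := by
  induction hu using augIdeal_induction with
  | zero => simp
  | add u u' _ _ h h' =>
    rw [TensorProduct.add_tmul, map_add]
    exact add_mem h h'
  | incl_succ p x =>
    induction hv using augIdeal_induction with
    | zero => simp
    | add v v' _ _ h h' =>
      rw [TensorProduct.tmul_add, map_add]
      exact add_mem h h'
    | incl_succ q y =>
      rw [← TensorProduct.map_tmul, mulMap_incl]
      exact incl_succ_mem_augIdeal (n := p + 1 + q) _

theorem augIdealSq_le_augIdeal : augIdealSq k V ≤ augIdeal k V := by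
  refine Submodule.span_le.2 ?_
  rintro _ ⟨u, hu, v, hv, rfl⟩
  exact mulMap_tmul_mem_augIdeal hu hv

theorem conv_apply_mem_augIdealSq {f g : TMod k V →ₗ[k] TMod k V}
    (hf : ∀ u, f u ∈ augIdeal k V) (hg : ∀ u, g u ∈ augIdeal k V) (u : TMod k V) :
    conv k V f g u ∈ augIdealSq k V := by
  simp only [conv, LinearMap.comp_apply]
  induction comul k V u with
  | zero => simp
  | add x y hx hy =>
    rw [map_add, map_add]
    exact add_mem hx hy
  | tmul x y => exact Submodule.subset_span ⟨f x, hf x, g y, hg y, rfl⟩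

theorem J_apply_mem_augIdeal (u : TMod k V) : J k V u ∈ augIdeal k V := by
  induction u using DirectSum.induction_on with
  | zero => simp
  | add x y hx hy =>
    rw [map_add]
    exact add_mem hx hy
  | of n x =>
    change J k V (incl k V n x) ∈ _
    cases n with
    | zero =>
      rw [J_incl_zero]
      exact zero_mem _
    | succ n =>
      rw [J_incl_succ]
      exact incl_succ_mem_augIdeal x

theorem convPow_J_apply_mem_augIdealSq (m : ℕ) (u : TMod k V) :
    convPow k V (J k V) (m + 2) u ∈ augIdealSq k V := by
  induction m generalizing u with
  | zero =>
    refine conv_apply_mem_augIdealSq J_apply_mem_augIdeal (fun u => ?_) u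
    rw [convPow_J_one]
    exact J_apply_mem_augIdeal u
  | succ m ih =>
    exact conv_apply_mem_augIdealSq J_apply_mem_augIdeal
      (fun u => augIdealSq_le_augIdeal (ih u)) u

theorem sub_euler1_mem_augIdealSq {u : TMod k V} (hu : u ∈ augIdeal k V) :
    u - euler1 k V u ∈ augIdealSq k V := by
  induction hu using augIdeal_induction with
  | zero => simp
  | add u u' _ _ h h' =>
    rw [map_add, add_sub_add_comm]
    exact add_mem h h'
  | incl_succ n x =>
    rw [euler1_incl, ← Finset.add_sum_Ioc_eq_sum_Icc (by omega), convPow_J_one, J_incl_succ]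
    simp only [one_add_one_eq_two, Nat.cast_one, even_two, Even.neg_pow, one_pow, inv_one, mul_one,
      one_smul, sub_add_cancel_left]
    refine neg_mem (Submodule.sum_mem _ fun m hm => Submodule.smul_mem _ _ ?_)
    obtain ⟨m, rfl⟩ := Nat.exists_eq_add_of_le' (Finset.mem_Ioc.1 hm).1
    exact convPow_J_apply_mem_augIdealSq m _

end Euler

section HochschildChains

omit [CharZero k]

variable {k A}

theorem mulC_tmul_tmul (a b : A) (u v : TMod k A) :
    mulC k A ((a ⊗ₜ u) ⊗ₜ (b ⊗ₜ v)) = (a * b) ⊗ₜ mulMap k A (u ⊗ₜ v) := by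
  simp [mulC]

theorem tmul_mem_augIdealC (a : A) {u : TMod k A} (hu : u ∈ augIdeal k A) :
    (a ⊗ₜ u : HChains k A) ∈ augIdealC k A :=
  ⟨a ⊗ₜ ⟨u, hu⟩, by simp⟩

@[elab_as_elim]
theorem augIdealC_induction {motive : (x : HChains k A) → x ∈ augIdealC k A → Prop}
    (tmul : ∀ (a : A) (u : TMod k A) (hu : u ∈ augIdeal k A),
      motive (a ⊗ₜ u) (tmul_mem_augIdealC a hu))
    (zero : motive 0 (zero_mem _))
    (add : ∀ x y hx hy, motive x hx → motive y hy → motive (x + y) (add_mem hx hy))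
    {x : HChains k A} (hx : x ∈ augIdealC k A) : motive x hx := by
  have key : ∀ z : A ⊗[k] augIdeal k A, motive
      (TensorProduct.map (LinearMap.id : A →ₗ[k] A) (Submodule.subtype (augIdeal k A)) z)
      ⟨z, rfl⟩ := by
    intro z
    induction z with
    | zero => simpa only [map_zero] using zero
    | add z w hz hw => simpa only [map_add] using add _ _ _ _ hz hw
    | tmul a u => exact tmul a u u.2
  obtain ⟨z, rfl⟩ := hx
  exact key z

theorem tmul_mem_augIdealCSq (a : A) {u : TMod k A} (hu : u ∈ augIdealSq k A) :
    (a ⊗ₜ u : HChains k A) ∈ augIdealCSq k A := by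
  induction hu using Submodule.span_induction with
  | zero => simp
  | add u v _ _ h h' =>
    rw [TensorProduct.tmul_add]
    exact add_mem h h'
  | smul c u _ h =>
    rw [TensorProduct.tmul_smul]
    exact Submodule.smul_mem _ c h
  | mem u hu =>
    obtain ⟨v, hv, w, hw, rfl⟩ := hu
    refine Submodule.subset_span
      ⟨a ⊗ₜ v, tmul_mem_augIdealC a hv, 1 ⊗ₜ w, tmul_mem_augIdealC 1 hw, ?_⟩
    rw [mulC_tmul_tmul, mul_one]

theorem euler1C_tmul (a : A) (u : TMod k A) : euler1C k A (a ⊗ₜ u) = a ⊗ₜ euler1 k A u := by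
  simp [euler1C]

theorem sub_euler1C_mem_augIdealCSq {x : HChains k A} (hx : x ∈ augIdealC k A) :
    x - euler1C k A x ∈ augIdealCSq k A := by
  induction hx using augIdealC_induction with
  | zero => simp
  | add x y _ _ h h' =>
    rw [map_add, add_sub_add_comm]
    exact add_mem h h'
  | tmul a u hu =>
    rw [euler1C_tmul, ← TensorProduct.tmul_sub]
    exact tmul_mem_augIdealCSq a (sub_euler1_mem_augIdealSq hu)

theorem mulC_mem_augIdealC_inf_ker [CharZero k] {x y : HChains k A} (hx : x ∈ augIdealC k A)
    (hy : y ∈ augIdealC k A) :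
    mulC k A (x ⊗ₜ y) ∈ augIdealC k A ⊓ LinearMap.ker (euler1C k A) := by
  induction hx using augIdealC_induction with
  | zero =>
    rw [TensorProduct.zero_tmul, LinearMap.map_zero]
    exact zero_mem _
  | add x x' _ _ h h' =>
    rw [TensorProduct.add_tmul, LinearMap.map_add]
    exact add_mem h h'
  | tmul a u hu =>
    induction hy using augIdealC_induction with
    | zero =>
      rw [TensorProduct.tmul_zero, LinearMap.map_zero]
      exact zero_mem _
    | add y y' _ _ h h' =>
      rw [TensorProduct.tmul_add, LinearMap.map_add]
      exact add_mem h h'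
    | tmul b v hv =>
      rw [mulC_tmul_tmul]
      refine ⟨tmul_mem_augIdealC _ (mulMap_tmul_mem_augIdeal hu hv), ?_⟩
      rw [SetLike.mem_coe, LinearMap.mem_ker, euler1C_tmul, euler1_mulMap hu hv,
        TensorProduct.tmul_zero]

theorem augIdealCSq_le [CharZero k] :
    augIdealCSq k A ≤ augIdealC k A ⊓ LinearMap.ker (euler1C k A) := by
  refine Submodule.span_le.2 ?_
  rintro _ ⟨x, hx, y, hy, rfl⟩
  exact mulC_mem_augIdealC_inf_ker hx hy

end HochschildChains

theorem sub_euler1_mem_augIdeal_sq :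
    (∀ a ∈ augIdealC k A, a - euler1C k A a ∈ augIdealCSq k A) ∧
    Submodule.map (idSubEuler1C k A) (augIdealC k A)
      = LinearMap.ker (euler1C k A) ⊓ augIdealC k A ∧
    LinearMap.ker (euler1C k A) ⊓ augIdealC k A ≤ augIdealCSq k A := by
  have hker : LinearMap.ker (euler1C k A) ⊓ augIdealC k A ≤ augIdealCSq k A := by
    rintro x ⟨hx, hx'⟩
    have := sub_euler1C_mem_augIdealCSq hx'
    rwa [LinearMap.mem_ker.1 hx, sub_zero] at this
  refine ⟨fun a => sub_euler1C_mem_augIdealCSq, le_antisymm ?_ ?_, hker⟩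
  · rintro _ ⟨x, hx, rfl⟩
    rw [inf_comm]
    exact augIdealCSq_le (sub_euler1C_mem_augIdealCSq hx)
  · rintro x ⟨hx, hx'⟩
    refine ⟨x, hx', ?_⟩
    change x - euler1C k A x = x
    rw [LinearMap.mem_ker.1 hx, sub_zero]

end
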